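/- For ψ ∈ S^2, the norm of the multiplication operator M_ψ on S^2 satisfies max{‖ψ‖_{S^2}, ‖ψ‖_∞} ≤ ‖M_ψ‖ ≤ (1 + 4π²/3)^{1/2} ‖ψ‖_{S^2}. -/

import Mathlib

open Metric Filter

noncomputable def taylorCoeff (f : ℂ → ℂ) (n : ℕ) : ℂ :=
  iteratedDeriv n f 0 / n.factorial

/-- Membership in `S²`: `f` is analytic on the open unit disk, equals its Taylor
series there, and its coefficients satisfy `Σ n² |a n|² < ∞`. -/
def MemS2 (f : ℂ → ℂ) : Prop :=
  AnalyticOn ℂ f (ball (0:ℂ) 1) ∧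
  (∀ z ∈ ball (0:ℂ) 1, HasSum (fun n : ℕ => taylorCoeff f n * z ^ n) (f z)) ∧
  Summable (fun n : ℕ => ((n : ℝ))^2 * ‖taylorCoeff f n‖^2)

/-- The square of the `S²` norm: `|a₀|² + Σ_{n≥1} n² |aₙ|²`. -/
noncomputable def s2NormSq (f : ℂ → ℂ) : ℝ :=
  ‖taylorCoeff f 0‖^2 + ∑' n : ℕ, ((n : ℝ) + 1)^2 * ‖taylorCoeff f (n+1)‖^2

noncomputable def s2Norm (f : ℂ → ℂ) : ℝ := Real.sqrt (s2NormSq f)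

/-- The square of the `H²` norm, in terms of Taylor coefficients. -/
noncomputable def h2NormSq (f : ℂ → ℂ) : ℝ := ∑' n : ℕ, ‖taylorCoeff f n‖^2

noncomputable def h2Norm (f : ℂ → ℂ) : ℝ := Real.sqrt (h2NormSq f)

/-- An operator on functions is bounded on `S²`. -/
def BoundedOpS2 (T : (ℂ → ℂ) → (ℂ → ℂ)) : Prop :=
  (∀ f, MemS2 f → MemS2 (T f)) ∧
  ∃ C : ℝ, ∀ f, MemS2 f → s2Norm (T f) ≤ C * s2Norm f

/-- The operator norm of an operator on `S²`. -/
noncomputable def opNormS2 (T : (ℂ → ℂ) → (ℂ → ℂ)) : ℝ :=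
  sInf {C : ℝ | 0 ≤ C ∧ ∀ f, MemS2 f → s2Norm (T f) ≤ C * s2Norm f}

/-- An (analytic) automorphism of the unit disk. -/
def IsDiskAut (φ : ℂ → ℂ) : Prop :=
  AnalyticOn ℂ φ (ball (0:ℂ) 1) ∧ Set.BijOn φ (ball (0:ℂ) 1) (ball (0:ℂ) 1)

noncomputable def wt (n : ℕ) : ℝ := max (n : ℝ) 1

lemma wt_pos (n : ℕ) : 0 < wt n := lt_of_lt_of_le one_pos (le_max_right _ _)

lemma one_le_wt (n : ℕ) : 1 ≤ wt n := le_max_right _ _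

lemma wt_zero : wt 0 = 1 := by simp [wt]

lemma wt_succ (n : ℕ) : wt (n + 1) = (n : ℝ) + 1 := by
  simp [wt]

lemma wt_add (k l : ℕ) : wt (k + l) ≤ wt k + wt l := by
  unfold wt
  apply max_le
  · push_cast
    exact add_le_add (le_max_left _ _) (le_max_left _ _)
  · have h1 := le_max_right (k : ℝ) 1
    have h2 := le_max_right (l : ℝ) 1
    linarith

lemma summable_wt_iff (a : ℕ → ℂ) :
    Summable (fun n : ℕ => (n : ℝ)^2 * ‖a n‖^2) ↔ Summable (fun n => wt n ^ 2 * ‖a n‖^2) := by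
  rw [← summable_nat_add_iff 1, ← summable_nat_add_iff (f := fun n => wt n ^ 2 * ‖a n‖^2) 1]
  simp [wt_succ]

lemma s2NormSq_eq {f : ℂ → ℂ} (hf : MemS2 f) :
    s2NormSq f = ∑' n, wt n ^ 2 * ‖taylorCoeff f n‖^2 := by
  rw [((summable_wt_iff _).1 hf.2.2).tsum_eq_zero_add]
  simp [s2NormSq, wt_zero, wt_succ]

lemma sum_wt (n : ℕ) : ∑ k ∈ Finset.range (n + 1), 1 / wt k ^ 2 ≤ 1 + Real.pi^2 / 6 := by
  rw [Finset.sum_range_succ']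
  have h := sum_le_hasSum (Finset.range (n + 1)) (fun i _ => by positivity) hasSum_zeta_two
  rw [Finset.sum_range_succ'] at h
  simp only [wt_zero, wt_succ]
  push_cast at h
  simp at h ⊢
  linarith

lemma sum_ratio (n : ℕ) : ∑ p ∈ Finset.HasAntidiagonal.antidiagonal n, (wt n / (wt p.1 * wt p.2)) ^ 2 ≤
    1 + 4 * Real.pi^2 / 3 := by
  have h1 : ∀ p ∈ Finset.HasAntidiagonal.antidiagonal n, (wt n / (wt p.1 * wt p.2)) ^ 2 ≤
      2 * (1 / wt p.1 ^ 2) + 2 * (1 / wt p.2 ^ 2) := by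
    intro p hp
    have hp' := Finset.HasAntidiagonal.mem_antidiagonal.1 hp
    have h1 := wt_pos p.1
    have h2 := wt_pos p.2
    have h3 := wt_add p.1 p.2
    rw [hp'] at h3
    have h4 : wt n / (wt p.1 * wt p.2) ≤ 1 / wt p.1 + 1 / wt p.2 := by
      rw [div_add_div _ _ h1.ne' h2.ne']
      gcongr
      linarith
    have h5 : 0 ≤ wt n / (wt p.1 * wt p.2) := by
      have := wt_pos n
      positivity
    calc _ ≤ (1 / wt p.1 + 1 / wt p.2)^2 := by gcongr
      _ ≤ _ := by
        rw [← one_div_pow, ← one_div_pow]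
        nlinarith [sq_nonneg (1 / wt p.1 - 1 / wt p.2)]
  have h2 : ∑ p ∈ Finset.HasAntidiagonal.antidiagonal n, (1 / wt p.1 ^ 2) ≤ 1 + Real.pi^2 / 6 := by
    rw [Finset.Nat.sum_antidiagonal_eq_sum_range_succ_mk]
    exact sum_wt n
  have h3 : ∑ p ∈ Finset.HasAntidiagonal.antidiagonal n, (1 / wt p.2 ^ 2) ≤ 1 + Real.pi^2 / 6 := by
    rw [← Finset.Nat.sum_antidiagonal_swap]
    exact h2
  refine (Finset.sum_le_sum h1).trans ?_
  rw [Finset.sum_add_distrib, ← Finset.mul_sum, ← Finset.mul_sum]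
  nlinarith [Real.pi_gt_three]

lemma coeff_bound (a b : ℕ → ℂ) (n : ℕ) :
    wt n ^ 2 * ‖∑ p ∈ Finset.HasAntidiagonal.antidiagonal n, a p.1 * b p.2‖ ^ 2 ≤
      (1 + 4 * Real.pi^2 / 3) * ∑ p ∈ Finset.HasAntidiagonal.antidiagonal n,
        (wt p.1 ^ 2 * ‖a p.1‖^2) * (wt p.2 ^ 2 * ‖b p.2‖^2) := by
  have hn := wt_pos n
  have h1 : wt n * ‖∑ p ∈ Finset.HasAntidiagonal.antidiagonal n, a p.1 * b p.2‖ ≤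
      ∑ p ∈ Finset.HasAntidiagonal.antidiagonal n, (wt n / (wt p.1 * wt p.2)) *
        ((wt p.1 * ‖a p.1‖) * (wt p.2 * ‖b p.2‖)) := by
    calc _ ≤ wt n * ∑ p ∈ Finset.HasAntidiagonal.antidiagonal n, ‖a p.1 * b p.2‖ := by
          gcongr
          exact norm_sum_le _ _
      _ = _ := by
          rw [Finset.mul_sum]
          refine Finset.sum_congr rfl fun p _ => ?_
          have h1 := (wt_pos p.1).ne'
          have h2 := (wt_pos p.2).ne'
          rw [norm_mul]
          field_simp
  rw [← mul_pow]
  calc _ ≤ _ := pow_le_pow_left₀ (by positivity) h1 2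
    _ ≤ _ := Finset.sum_mul_sq_le_sq_mul_sq _ _ _
    _ ≤ (1 + 4 * Real.pi^2 / 3) * ∑ p ∈ Finset.HasAntidiagonal.antidiagonal n,
        ((wt p.1 * ‖a p.1‖) * (wt p.2 * ‖b p.2‖)) ^ 2 := by
          gcongr
          exact sum_ratio n
    _ = _ := by simp only [mul_pow]

lemma contDiffAt_of_mem {f : ℂ → ℂ} (hf : MemS2 f) (n : ℕ) : ContDiffAt ℂ n f 0 := by
  have := (Metric.isOpen_ball.analyticOn_iff_analyticOnNhd).1 hf.1 0 (by simp)
  exact this.contDiffAt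

lemma taylorCoeff_mul {f g : ℂ → ℂ} (hf : MemS2 f) (hg : MemS2 g) (n : ℕ) :
    taylorCoeff (fun z => f z * g z) n =
      ∑ p ∈ Finset.HasAntidiagonal.antidiagonal n, taylorCoeff f p.1 * taylorCoeff g p.2 := by
  unfold taylorCoeff
  rw [iteratedDeriv_fun_mul (contDiffAt_of_mem hf n) (contDiffAt_of_mem hg n),
    Finset.Nat.sum_antidiagonal_eq_sum_range_succ_mk, Finset.sum_div]
  refine Finset.sum_congr rfl fun k hk => ?_
  have hk' : k ≤ n := by simpa [Nat.lt_succ_iff] using hk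
  have h := Nat.choose_mul_factorial_mul_factorial hk'
  have h' : (n.choose k : ℂ) * k.factorial * (n - k).factorial = n.factorial := by
    exact_mod_cast h
  have h1 : (k.factorial : ℂ) ≠ 0 := by exact_mod_cast k.factorial_ne_zero
  have h2 : ((n - k).factorial : ℂ) ≠ 0 := by exact_mod_cast (n - k).factorial_ne_zero
  have h3 : (n.choose k : ℂ) ≠ 0 := by exact_mod_cast (Nat.choose_pos hk').ne'
  rw [← h']
  field_simp

lemma mul_mem {f g : ℂ → ℂ} (hf : MemS2 f) (hg : MemS2 g) :
    MemS2 (fun z => f z * g z) ∧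
      s2NormSq (fun z => f z * g z) ≤ (1 + 4 * Real.pi^2 / 3) * (s2NormSq f * s2NormSq g) := by
  have sf := (summable_wt_iff _).1 hf.2.2
  have sg := (summable_wt_iff _).1 hg.2.2
  have sfn : Summable (fun n => ‖wt n ^ 2 * ‖taylorCoeff f n‖^2‖) := sf.norm
  have sgn : Summable (fun n => ‖wt n ^ 2 * ‖taylorCoeff g n‖^2‖) := sg.norm
  have S := (summable_norm_sum_mul_antidiagonal_of_summable_norm sfn sgn).of_norm
  have S2 := S.mul_left (1 + 4 * Real.pi^2 / 3)
  have hb := coeff_bound (taylorCoeff f) (taylorCoeff g)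
  have S3 : Summable (fun n => wt n ^ 2 * ‖taylorCoeff (fun z => f z * g z) n‖^2) := by
    refine Summable.of_nonneg_of_le (fun n => by positivity) (fun n => ?_) S2
    rw [taylorCoeff_mul hf hg]
    exact hb n
  have M : MemS2 (fun z => f z * g z) := by
    refine ⟨hf.1.mul hg.1, fun z hz => ?_, (summable_wt_iff _).2 S3⟩
    have h1 := hf.2.1 z hz
    have h2 := hg.2.1 z hz
    have n1 := h1.summable.norm
    have n2 := h2.summable.norm
    have hs := (summable_norm_sum_mul_antidiagonal_of_summable_norm n1 n2).of_norm.hasSum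
    rw [← tsum_mul_tsum_eq_tsum_sum_antidiagonal_of_summable_norm n1 n2, h1.tsum_eq,
      h2.tsum_eq] at hs
    suffices e : (fun n => taylorCoeff (fun z => f z * g z) n * z ^ n) = fun n =>
        ∑ p ∈ Finset.HasAntidiagonal.antidiagonal n,
          taylorCoeff f p.1 * z ^ p.1 * (taylorCoeff g p.2 * z ^ p.2) by
      rw [e]
      exact hs
    funext n
    rw [taylorCoeff_mul hf hg, Finset.sum_mul]
    refine Finset.sum_congr rfl fun p hp => ?_
    rw [← Finset.HasAntidiagonal.mem_antidiagonal.1 hp, pow_add]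
    ring
  refine ⟨M, ?_⟩
  rw [s2NormSq_eq M, s2NormSq_eq hf, s2NormSq_eq hg,
    tsum_mul_tsum_eq_tsum_sum_antidiagonal_of_summable_norm sfn sgn, ← tsum_mul_left]
  refine S3.tsum_le_tsum (fun n => ?_) S2
  rw [taylorCoeff_mul hf hg]
  exact hb n

lemma s2NormSq_nonneg (f : ℂ → ℂ) : 0 ≤ s2NormSq f := by
  unfold s2NormSq
  have : 0 ≤ ∑' n : ℕ, ((n : ℝ) + 1)^2 * ‖taylorCoeff f (n+1)‖^2 :=
    tsum_nonneg fun n => by positivity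
  positivity

lemma s2Norm_mul {f g : ℂ → ℂ} (hf : MemS2 f) (hg : MemS2 g) :
    s2Norm (fun z => f z * g z) ≤ Real.sqrt (1 + 4 * Real.pi^2 / 3) * s2Norm f * s2Norm g := by
  unfold s2Norm
  rw [mul_assoc, ← Real.sqrt_mul (s2NormSq_nonneg f), ← Real.sqrt_mul (by positivity)]
  exact Real.sqrt_le_sqrt (mul_mem hf hg).2

lemma taylorCoeff_one (n : ℕ) : taylorCoeff (fun _ => 1) n = if n = 0 then 1 else 0 := by
  unfold taylorCoeff
  rw [iteratedDeriv_const]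
  split_ifs with h <;> simp [h]

lemma one_mem : MemS2 (fun _ => 1) := by
  refine ⟨analyticOn_const, fun z _ => ?_, ?_⟩
  · have := hasSum_ite_eq (0 : ℕ) (1 : ℂ)
    convert this using 2 with n
    rw [taylorCoeff_one]
    split_ifs with h <;> simp [h]
  · convert summable_zero with n
    rw [taylorCoeff_one]
    split_ifs with h <;> simp [h]

lemma s2Norm_one : s2Norm (fun _ => 1) = 1 := by
  simp [s2Norm, s2NormSq, taylorCoeff_one]

lemma coeff_le {f : ℂ → ℂ} (hf : MemS2 f) (n : ℕ) : ‖taylorCoeff f n‖ ≤ s2Norm f := by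
  apply Real.le_sqrt_of_sq_le
  rw [s2NormSq_eq hf]
  have h := ((summable_wt_iff _).1 hf.2.2).le_tsum n (fun j _ => by positivity)
  refine le_trans ?_ h
  have : 1 ≤ wt n ^ 2 := one_le_pow₀ (one_le_wt n)
  nlinarith [sq_nonneg ‖taylorCoeff f n‖]

lemma eval_le {f : ℂ → ℂ} (hf : MemS2 f) {z : ℂ} (hz : z ∈ ball (0:ℂ) 1) :
    ‖f z‖ ≤ (1 - ‖z‖)⁻¹ * s2Norm f := by
  have hz' : ‖z‖ < 1 := by simpa using hz
  have hg := (hasSum_geometric_of_lt_one (norm_nonneg z) hz').mul_right (s2Norm f)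
  have h := hf.2.1 z hz
  rw [← h.tsum_eq]
  refine tsum_of_norm_bounded hg fun n => ?_
  rw [norm_mul, norm_pow, mul_comm]
  exact mul_le_mul_of_nonneg_left (coeff_le hf n) (by positivity)

lemma s2_pow_mem {ψ : ℂ → ℂ} (hψ : MemS2 ψ) {C : ℝ} (hC : 0 ≤ C)
    (h : ∀ f, MemS2 f → s2Norm (fun z => ψ z * f z) ≤ C * s2Norm f) (n : ℕ) :
    MemS2 (fun z => ψ z ^ n) ∧ s2Norm (fun z => ψ z ^ n) ≤ C ^ n := by
  induction n with
  | zero => simpa [s2Norm_one] using one_mem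
  | succ n ih =>
    simp only [pow_succ']
    exact ⟨(mul_mem hψ ih.1).1, (h _ ih.1).trans (mul_le_mul_of_nonneg_left ih.2 hC)⟩

lemma le_of_pow_le {x C K : ℝ} (hC : 0 ≤ C) (h : ∀ n : ℕ, x ^ n ≤ K * C ^ n) : x ≤ C := by
  by_contra! hlt
  rcases hC.eq_or_lt with rfl | hC
  · have := h 1
    simp at this
    linarith
  · have h1 : 1 < x / C := (one_lt_div hC).2 hlt
    obtain ⟨n, hn⟩ := pow_unbounded_of_one_lt K h1
    rw [div_pow, lt_div_iff₀ (by positivity)] at hn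
    linarith [h n]

theorem multiplication_norm_bounds (ψ : ℂ → ℂ) (hψ : MemS2 ψ) :
    s2Norm ψ ≤ opNormS2 (fun f => fun z => ψ z * f z) ∧
      (∀ z ∈ ball (0:ℂ) 1, ‖ψ z‖ ≤ opNormS2 (fun f => fun z => ψ z * f z)) ∧
      opNormS2 (fun f => fun z => ψ z * f z) ≤
        Real.sqrt (1 + 4 * Real.pi^2 / 3) * s2Norm ψ := by
  have hmem : Real.sqrt (1 + 4 * Real.pi^2 / 3) * s2Norm ψ ∈
      {C : ℝ | 0 ≤ C ∧ ∀ f, MemS2 f →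
        s2Norm ((fun f => fun z => ψ z * f z) f) ≤ C * s2Norm f} :=
    ⟨mul_nonneg (Real.sqrt_nonneg _) (Real.sqrt_nonneg _), fun f hf => s2Norm_mul hψ hf⟩
  refine ⟨le_csInf ⟨_, hmem⟩ ?_, fun z hz => le_csInf ⟨_, hmem⟩ ?_,
    csInf_le ⟨0, fun C hC => hC.1⟩ hmem⟩
  · rintro C ⟨_, h⟩
    have := h _ one_mem
    simpa [s2Norm_one] using this
  · rintro C ⟨hC, h⟩
    have hz' : ‖z‖ < 1 := by simpa using hz
    refine le_of_pow_le (K := (1 - ‖z‖)⁻¹) hC fun n => ?_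
    obtain ⟨h1, h2⟩ := s2_pow_mem hψ hC h n
    have h3 := eval_le h1 hz
    rw [norm_pow] at h3
    refine h3.trans (mul_le_mul_of_nonneg_left h2 ?_)
    exact inv_nonneg.2 (by linarith)
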